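/- Let M be a k-pass streaming algorithm on an input stream X_1,…,X_n drawn from a product distribution. Then Σ_{j=1}^{n} I(X_j; M_{(≤k,j-1)}, M_{<k}) ≤ H(M_{<k}). -/

import Mathlib

open scoped Classical
open Finset

noncomputable section

namespace MultiPassIC

/-- Probability of an event under a probability mass function `p` on a finite sample space. -/
def pr {Ω : Type} [Fintype Ω] (p : Ω → ℝ) (E : Ω → Prop) : ℝ :=
  ∑ ω, if E ω then p ω else 0

/-- `p` is a probability mass function on the finite type `Ω`. -/
structure IsPMF {Ω : Type} [Fintype Ω] (p : Ω → ℝ) : Prop where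
  nonneg : ∀ ω, 0 ≤ p ω
  sum_one : ∑ ω, p ω = 1

/-- Shannon entropy (base 2) of the random variable `A` under `p`. -/
def H {Ω : Type} [Fintype Ω] {α : Type} [Fintype α] (p : Ω → ℝ) (A : Ω → α) : ℝ :=
  -∑ a, pr p (fun ω => A ω = a) * Real.logb 2 (pr p (fun ω => A ω = a))

/-- Conditional mutual information `I(A ; B ∣ C)` (base 2), with the usual conventions
for vanishing probabilities. -/
def condMI {Ω : Type} [Fintype Ω] {α β γ : Type} [Fintype α] [Fintype β] [Fintype γ]
    (p : Ω → ℝ) (A : Ω → α) (B : Ω → β) (C : Ω → γ) : ℝ :=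
  ∑ a, ∑ b, ∑ c,
    pr p (fun ω => A ω = a ∧ B ω = b ∧ C ω = c) *
      Real.logb 2 ((pr p (fun ω => C ω = c) *
          pr p (fun ω => A ω = a ∧ B ω = b ∧ C ω = c)) /
        (pr p (fun ω => A ω = a ∧ C ω = c) * pr p (fun ω => B ω = b ∧ C ω = c)))

/-- Mutual information `I(A ; B)` (base 2). -/
def MI {Ω : Type} [Fintype Ω] {α β : Type} [Fintype α] [Fintype β]
    (p : Ω → ℝ) (A : Ω → α) (B : Ω → β) : ℝ :=
  condMI p A B (fun _ => (0 : Fin 1))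

/-- `X 0, …, X (n-1)` (the first `n` stream elements) are mutually independent under `p`,
i.e. they are drawn from a product distribution. -/
def IsProduct {Ω : Type} [Fintype Ω] {𝒳 : Type} (p : Ω → ℝ) (n : ℕ) (X : ℕ → Ω → 𝒳) : Prop :=
  ∀ x : ℕ → 𝒳,
    pr p (fun ω => ∀ j < n, X j ω = x j) =
      ∏ j ∈ Finset.range n, pr p (fun ω => X j ω = x j)

/-- A `k`-pass streaming algorithm on the input stream `X 0, …, X (n-1)` (0-indexed;
the paper's `X_j` is `X (j-1)`), over a finite sample space `Ω` with pmf `p`.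
`S` is the finite set of memory states, `Rv` the value space of the per-step private
randomness, `init` the initial memory state `M₀`, `R i j` the private randomness used at
step `j` of pass `i` (0-indexed), and `f i j` the corresponding transition function.
The field `indep` states that the initial state, all the per-step random seeds, and the
input stream are mutually independent. -/
structure Alg (Ω : Type) [Fintype Ω] (p : Ω → ℝ) (𝒳 : Type) [Fintype 𝒳]
    (n k : ℕ) (X : ℕ → Ω → 𝒳) where
  S : Type
  fintS : Fintype S
  Rv : Type
  fintR : Fintype Rv
  init : Ω → S
  R : ℕ → ℕ → Ω → Rv
  f : ℕ → ℕ → 𝒳 → S → Rv → S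
  indep : ∀ (m : S) (r : ℕ → ℕ → Rv) (x : ℕ → 𝒳),
    pr p (fun ω => init ω = m ∧ (∀ i < k, ∀ j < n, R i j ω = r i j) ∧ (∀ j < n, X j ω = x j))
      = pr p (fun ω => init ω = m)
        * (∏ i ∈ Finset.range k, ∏ j ∈ Finset.range n, pr p (fun ω => R i j ω = r i j))
        * pr p (fun ω => ∀ j < n, X j ω = x j)

attribute [instance] Alg.fintS Alg.fintR

variable {Ω : Type} [Fintype Ω] {p : Ω → ℝ} {𝒳 : Type} [Fintype 𝒳] {n k : ℕ} {X : ℕ → Ω → 𝒳}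

/-- Running pass `i` (0-indexed) of the algorithm for `j` steps starting from `ini`. -/
def Alg.runPass (M : Alg Ω p 𝒳 n k X) (i : ℕ) (ini : Ω → M.S) : ℕ → Ω → M.S
  | 0 => ini
  | j + 1 => fun ω =>
      if j < n ∧ i < k then
        M.f i j (X j ω) (M.runPass i ini j ω) (M.R i j ω)
      else M.runPass i ini j ω

/-- `M.passEnd i` is the memory state at the end of pass `i`; `M.passEnd 0 = M₀` is the
initial state, and `M.passEnd i` is the paper's `M_i = M_{(i,n)}`. -/
def Alg.passEnd (M : Alg Ω p 𝒳 n k X) : ℕ → Ω → M.S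
  | 0 => M.init
  | i + 1 => M.runPass i (M.passEnd i) n

/-- `M.st i j` is the memory state after reading `j` elements in pass `i+1`;
it is the paper's `M_{(i+1, j)}`. -/
def Alg.st (M : Alg Ω p 𝒳 n k X) (i j : ℕ) : Ω → M.S :=
  M.runPass i (M.passEnd i) j

/-- The multi-pass information cost
`MIC(M, μ) = Σ_{i=1}^{k} Σ_{j=1}^{n} Σ_{ℓ=1}^{j} I(M_{(i,j)}; X_ℓ | M_{(≤i,ℓ-1)}, M_{(≤i-1,j)})
  + Σ_{i=1}^{k} Σ_{j=1}^{n} Σ_{ℓ=j+1}^{n} I(M_{(i,j)}; X_ℓ | M_{(≤i-1,ℓ-1)}, M_{(≤i-1,j)})`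
(all summation indices below are 0-indexed shifts of the paper's 1-indexed ones). -/
def Alg.MIC (M : Alg Ω p 𝒳 n k X) : ℝ :=
  (∑ i ∈ Finset.range k, ∑ j ∈ Finset.range n, ∑ l ∈ Finset.range (j + 1),
    condMI p (M.st i (j + 1)) (X l)
      (fun ω => ((fun r : Fin (i + 1) => M.st r.1 l ω),
                 (fun r : Fin i => M.st r.1 (j + 1) ω))))
  + (∑ i ∈ Finset.range k, ∑ j ∈ Finset.range n, ∑ l ∈ Finset.Ico (j + 1) n,
    condMI p (M.st i (j + 1)) (X l)
      (fun ω => ((fun r : Fin i => M.st r.1 l ω),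
                 (fun r : Fin i => M.st r.1 (j + 1) ω))))

/-- The conditional information cost
`MIC_cond(M, μ) = Σ_{j=1}^{n} Σ_{ℓ=1}^{j} I(M_{(≤k,j)}; X_ℓ | M_{<k}, M_{(≤k,ℓ-1)})`. -/
def Alg.MICcond (M : Alg Ω p 𝒳 n k X) : ℝ :=
  ∑ j ∈ Finset.range n, ∑ l ∈ Finset.range (j + 1),
    condMI p (fun ω => fun r : Fin k => M.st r.1 (j + 1) ω) (X l)
      (fun ω => ((fun r : Fin k => M.passEnd r.1 ω),
                 (fun r : Fin k => M.st r.1 l ω)))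

end MultiPassIC

namespace MultiPassIC

section Entropy

variable {Ω : Type} [Fintype Ω] {p : Ω → ℝ} {α β γ : Type}

lemma pr_mono (hp : IsPMF p) {E F : Ω → Prop} (h : ∀ ω, E ω → F ω) : pr p E ≤ pr p F := by
  refine Finset.sum_le_sum fun ω _ => ?_
  have := hp.nonneg ω
  by_cases hE : E ω
  · simp [hE, h ω hE]
  · by_cases hF : F ω <;> simp [hE, hF, this]

lemma pr_nonneg (hp : IsPMF p) (E : Ω → Prop) : 0 ≤ pr p E :=
  Finset.sum_nonneg fun ω _ => by
    have := hp.nonneg ω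
    split_ifs <;> simp [this]

lemma pr_true (hp : IsPMF p) : pr p (fun _ => True) = 1 := by
  simp [pr, hp.sum_one]

lemma pr_le_one (hp : IsPMF p) (E : Ω → Prop) : pr p E ≤ 1 :=
  pr_true hp ▸ pr_mono hp fun _ _ => trivial

lemma pr_pos (hp : IsPMF p) {E : Ω → Prop} {ω : Ω} (hω : 0 < p ω) (hE : E ω) : 0 < pr p E := by
  have h := Finset.single_le_sum (f := fun ω => if E ω then p ω else 0)
    (fun ω _ => by have := hp.nonneg ω; split_ifs <;> simp [this])
    (Finset.mem_univ ω)
  simp only [hE, if_true] at h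
  exact hω.trans_le h

/-- The law of total probability. -/
lemma sum_pr_and_eq [Fintype α] (A : Ω → α) (E : Ω → Prop) :
    ∑ a, pr p (fun ω => A ω = a ∧ E ω) = pr p E := by
  unfold pr
  rw [Finset.sum_comm]
  refine Finset.sum_congr rfl fun ω _ => ?_
  by_cases hE : E ω <;> simp [hE]

/-- The expectation of a function of `A`, as a sum over the values of `A`. -/
lemma sum_mul_comp [Fintype α] (A : Ω → α) (F : α → ℝ) :
    ∑ ω, p ω * F (A ω) = ∑ a, pr p (fun ω => A ω = a) * F a := by
  simp only [pr, Finset.sum_mul]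
  rw [Finset.sum_comm]
  refine Finset.sum_congr rfl fun ω _ => ?_
  simp

lemma H_eq_sum [Fintype α] (A : Ω → α) :
    H p A = -∑ ω, p ω * Real.logb 2 (pr p (fun ω' => A ω' = A ω)) := by
  rw [H, sum_mul_comp A fun a => Real.logb 2 (pr p (fun ω' => A ω' = a))]

lemma H_nonneg [Fintype α] (hp : IsPMF p) (A : Ω → α) : 0 ≤ H p A := by
  rw [H, neg_nonneg]
  exact Finset.sum_nonpos fun a _ => mul_nonpos_of_nonneg_of_nonpos (pr_nonneg hp _)
    (Real.logb_nonpos one_lt_two (pr_nonneg hp _) (pr_le_one hp _))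

/-- If `B` determines `A`, then the entropy of `A` is at most that of `B`. -/
lemma H_le_of_determines [Fintype α] [Fintype β] (hp : IsPMF p) {A : Ω → α} {B : Ω → β}
    (h : ∀ ω ω', B ω = B ω' → A ω = A ω') : H p A ≤ H p B := by
  rw [H_eq_sum, H_eq_sum, neg_le_neg_iff]
  refine Finset.sum_le_sum fun ω _ => ?_
  rcases (hp.nonneg ω).eq_or_lt with h0 | h0
  · simp [← h0]
  · exact mul_le_mul_of_nonneg_left (Real.logb_le_logb_of_le one_lt_two
      (pr_pos hp h0 rfl) (pr_mono hp fun ω' => h ω' ω)) h0.le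

/-- Submodularity of Shannon entropy. -/
lemma H_submodular [Fintype α] [Fintype β] [Fintype γ] (hp : IsPMF p)
    (A : Ω → α) (B : Ω → β) (C : Ω → γ) :
    H p (fun ω => (A ω, B ω, C ω)) + H p C
      ≤ H p (fun ω => (A ω, C ω)) + H p (fun ω => (B ω, C ω)) := by
  simp only [H_eq_sum, Prod.mk.injEq]
  set s : α × β × γ → ℝ := fun x => pr p (fun ω => A ω = x.1 ∧ B ω = x.2.1 ∧ C ω = x.2.2) with hs
  set u : α × β × γ → ℝ := fun x => pr p (fun ω => A ω = x.1 ∧ C ω = x.2.2) with hu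
  set v : α × β × γ → ℝ := fun x => pr p (fun ω => B ω = x.2.1 ∧ C ω = x.2.2) with hv
  set t : α × β × γ → ℝ := fun x => pr p (fun ω => C ω = x.2.2) with ht
  set T : Ω → α × β × γ := fun ω => (A ω, B ω, C ω) with hT
  have ratio : ∑ ω, p ω * (u (T ω) * v (T ω) / (s (T ω) * t (T ω))) ≤ 1 := by
    rw [sum_mul_comp T fun x => u x * v x / (s x * t x)]
    have bound : ∀ x, pr p (fun ω => T ω = x) * (u x * v x / (s x * t x)) ≤ u x * v x / t x := by
      intro x
      have hsx : pr p (fun ω => T ω = x) = s x := by simp [hs, hT, Prod.ext_iff]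
      have hnn : 0 ≤ u x * v x / t x :=
        div_nonneg (mul_nonneg (pr_nonneg hp _) (pr_nonneg hp _)) (pr_nonneg hp _)
      rw [hsx]
      rcases eq_or_ne (s x) 0 with h0 | h0
      · simpa [h0] using hnn
      · rw [← mul_div_assoc, mul_div_mul_left _ _ h0]
    refine (Finset.sum_le_sum fun x _ => bound x).trans ?_
    rw [Fintype.sum_prod_type_right, Fintype.sum_prod_type_right]
    have total : ∑ c, pr p (fun ω => C ω = c) = 1 := by
      simpa [pr_true hp] using sum_pr_and_eq (p := p) C fun _ => True
    rw [← total]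
    refine Finset.sum_le_sum fun c _ => ?_
    simp only [hu, hv, ht, ← Finset.sum_div, ← Finset.sum_mul, ← Finset.mul_sum]
    rw [sum_pr_and_eq A fun ω => C ω = c, sum_pr_and_eq B fun ω => C ω = c, mul_self_div_self]
  have term : ∀ ω, p ω * Real.logb 2 (u (T ω)) + p ω * Real.logb 2 (v (T ω))
      - p ω * Real.logb 2 (s (T ω)) - p ω * Real.logb 2 (t (T ω))
      ≤ (p ω * (u (T ω) * v (T ω) / (s (T ω) * t (T ω))) - p ω) / Real.log 2 := by
    intro ω
    rcases (hp.nonneg ω).eq_or_lt with h0 | h0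
    · simp [← h0]
    · have hs0 : 0 < s (T ω) := pr_pos hp h0 ⟨rfl, rfl, rfl⟩
      have hu0 : 0 < u (T ω) := pr_pos hp h0 ⟨rfl, rfl⟩
      have hv0 : 0 < v (T ω) := pr_pos hp h0 ⟨rfl, rfl⟩
      have ht0 : 0 < t (T ω) := pr_pos hp h0 rfl
      have hlog := Real.log_le_sub_one_of_pos (x := u (T ω) * v (T ω) / (s (T ω) * t (T ω)))
        (by positivity)
      rw [Real.log_div (by positivity) (by positivity), Real.log_mul hu0.ne' hv0.ne',
        Real.log_mul hs0.ne' ht0.ne'] at hlog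
      have hmul := mul_le_mul_of_nonneg_left hlog h0.le
      rw [mul_sub_one] at hmul
      refine le_of_eq_of_le ?_ (div_le_div_of_nonneg_right hmul (Real.log_pos one_lt_two).le)
      simp only [Real.logb]
      ring
  have hsum := Finset.sum_le_sum fun ω (_ : ω ∈ Finset.univ) => term ω
  rw [← Finset.sum_div, Finset.sum_sub_distrib _ p, hp.sum_one] at hsum
  simp only [Finset.sum_sub_distrib, Finset.sum_add_distrib] at hsum
  have hneg := div_nonpos_of_nonpos_of_nonneg (sub_nonpos.2 ratio) (Real.log_pos one_lt_two).le
  have := hsum.trans hneg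
  simp only [hs, hu, hv, ht, hT] at this
  linarith

lemma condMI_eq [Fintype α] [Fintype β] [Fintype γ] (hp : IsPMF p)
    (A : Ω → α) (B : Ω → β) (C : Ω → γ) :
    condMI p A B C = H p (fun ω => (A ω, C ω)) + H p (fun ω => (B ω, C ω))
      - H p (fun ω => (A ω, B ω, C ω)) - H p C := by
  have h := sum_mul_comp (p := p) (fun ω => (A ω, B ω, C ω)) fun x =>
    Real.logb 2 ((pr p (fun ω => C ω = x.2.2) *
          pr p (fun ω => A ω = x.1 ∧ B ω = x.2.1 ∧ C ω = x.2.2)) /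
        (pr p (fun ω => A ω = x.1 ∧ C ω = x.2.2) * pr p (fun ω => B ω = x.2.1 ∧ C ω = x.2.2)))
  simp only [Fintype.sum_prod_type, Prod.mk.injEq] at h
  rw [condMI, ← h]
  simp only [H_eq_sum, Prod.mk.injEq, sub_eq_add_neg, neg_neg]
  simp only [← Finset.sum_neg_distrib, ← Finset.sum_add_distrib]
  refine Finset.sum_congr rfl fun ω _ => ?_
  rcases (hp.nonneg ω).eq_or_lt with h0 | h0
  · simp [← h0]
  · have hs := pr_pos (E := fun ω' => A ω' = A ω ∧ B ω' = B ω ∧ C ω' = C ω) hp h0 ⟨rfl, rfl, rfl⟩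
    have hu := pr_pos (E := fun ω' => A ω' = A ω ∧ C ω' = C ω) hp h0 ⟨rfl, rfl⟩
    have hv := pr_pos (E := fun ω' => B ω' = B ω ∧ C ω' = C ω) hp h0 ⟨rfl, rfl⟩
    have ht := pr_pos (E := fun ω' => C ω' = C ω) hp h0 rfl
    rw [Real.logb_div (by positivity) (by positivity), Real.logb_mul ht.ne' hs.ne',
      Real.logb_mul hu.ne' hv.ne']
    ring

lemma MI_eq [Fintype α] [Fintype β] (hp : IsPMF p) (A : Ω → α) (B : Ω → β) :
    MI p A B = H p A + H p B - H p (fun ω => (A ω, B ω)) := by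
  have hA : H p (fun ω => (A ω, (0 : Fin 1))) = H p A :=
    le_antisymm (H_le_of_determines hp (by simp)) (H_le_of_determines hp (by simp))
  have hB : H p (fun ω => (B ω, (0 : Fin 1))) = H p B :=
    le_antisymm (H_le_of_determines hp (by simp)) (H_le_of_determines hp (by simp))
  have hAB : H p (fun ω => (A ω, B ω, (0 : Fin 1))) = H p (fun ω => (A ω, B ω)) :=
    le_antisymm (H_le_of_determines hp (by simp)) (H_le_of_determines hp (by simp))
  have h0 : H p (fun _ => (0 : Fin 1)) = 0 := by
    rw [H_eq_sum]
    simp [pr_true hp]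
  rw [MI, condMI_eq hp, hA, hB, hAB, h0, sub_zero]

/-- Additivity of entropy for independent random variables. -/
lemma H_prod_of_indep [Fintype α] [Fintype β] (hp : IsPMF p) {A : Ω → α} {B : Ω → β}
    (h : ∀ ω, pr p (fun ω' => A ω' = A ω ∧ B ω' = B ω)
      = pr p (fun ω' => A ω' = A ω) * pr p (fun ω' => B ω' = B ω)) :
    H p (fun ω => (A ω, B ω)) = H p A + H p B := by
  simp only [H_eq_sum, Prod.mk.injEq, h, ← Finset.sum_neg_distrib, ← Finset.sum_add_distrib]
  refine Finset.sum_congr rfl fun ω _ => ?_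
  rcases (hp.nonneg ω).eq_or_lt with h0 | h0
  · simp [← h0]
  · have hA := pr_pos (E := fun ω' => A ω' = A ω) hp h0 rfl
    have hB := pr_pos (E := fun ω' => B ω' = B ω) hp h0 rfl
    rw [Real.logb_mul hA.ne' hB.ne']
    ring

/-- A product formula for a family of random variables passes to the family with one
member removed. -/
lemma pr_forall_mem_of_insert {ι V : Type} [Fintype V] (hp : IsPMF p) {Y : ι → Ω → V}
    {E : Ω → Prop} {c : ℝ} {s : Finset ι} {a : ι} (ha : a ∉ s)
    (h : ∀ v : ι → V, pr p (fun ω => (∀ i ∈ insert a s, Y i ω = v i) ∧ E ω)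
      = (∏ i ∈ insert a s, pr p (fun ω => Y i ω = v i)) * c) (v : ι → V) :
    pr p (fun ω => (∀ i ∈ s, Y i ω = v i) ∧ E ω)
      = (∏ i ∈ s, pr p (fun ω => Y i ω = v i)) * c := by
  have hne : ∀ i ∈ s, i ≠ a := fun i hi hia => ha (hia ▸ hi)
  have hy : ∀ y, pr p (fun ω => Y a ω = y ∧ (∀ i ∈ s, Y i ω = v i) ∧ E ω)
      = pr p (fun ω => Y a ω = y ∧ True) * ((∏ i ∈ s, pr p (fun ω => Y i ω = v i)) * c) := by
    intro y
    have h1 := h (Function.update v a y)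
    rw [Finset.prod_insert ha, Finset.prod_congr rfl
      (g := fun i => pr p (fun ω => Y i ω = v i))
      (fun i hi => by rw [Function.update_of_ne (hne i hi)])] at h1
    simp only [Function.update_self, Finset.forall_mem_insert] at h1
    simp only [and_true]
    rw [← mul_assoc, ← h1]
    congr 1
    ext ω
    rw [← and_assoc]
    refine and_congr (and_congr Iff.rfl (forall₂_congr fun i hi => ?_)) Iff.rfl
    rw [Function.update_of_ne (hne i hi)]
  rw [← sum_pr_and_eq (Y a)]
  simp only [hy]
  rw [← Finset.sum_mul, sum_pr_and_eq, pr_true hp, one_mul]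

/-- A product formula for a family of random variables passes to subfamilies. -/
lemma pr_forall_mem_of_subset {ι V : Type} [Fintype V] (hp : IsPMF p) {Y : ι → Ω → V}
    {E : Ω → Prop} {c : ℝ} {s t : Finset ι} (hts : t ⊆ s)
    (h : ∀ v : ι → V, pr p (fun ω => (∀ i ∈ s, Y i ω = v i) ∧ E ω)
      = (∏ i ∈ s, pr p (fun ω => Y i ω = v i)) * c) :
    ∀ v : ι → V, pr p (fun ω => (∀ i ∈ t, Y i ω = v i) ∧ E ω)
      = (∏ i ∈ t, pr p (fun ω => Y i ω = v i)) * c := by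
  obtain ⟨u, rfl⟩ : ∃ u, t ∪ u = s := ⟨s, Finset.union_eq_right.2 hts⟩
  clear hts
  induction u using Finset.induction_on with
  | empty => simpa using h
  | insert a u _ ih =>
    rw [Finset.union_insert] at h
    by_cases ha : a ∈ t ∪ u
    · exact ih (by rwa [Finset.insert_eq_of_mem ha] at h)
    · exact ih (pr_forall_mem_of_insert hp ha h)

end Entropy

section Streaming

variable {Ω : Type} [Fintype Ω] {p : Ω → ℝ} {𝒳 : Type} [Fintype 𝒳] {n k : ℕ} {X : ℕ → Ω → 𝒳}

/-- All the seeds and all the stream elements are mutually independent. -/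
lemma Alg.pr_seeds_and_stream (hp : IsPMF p) (hprod : IsProduct p n X) (M : Alg Ω p 𝒳 n k X)
    {t : Finset (ℕ × ℕ)} {u : Finset ℕ} (ht : t ⊆ range k ×ˢ range n) (hu : u ⊆ range n)
    (r : ℕ × ℕ → M.Rv) (x : ℕ → 𝒳) :
    pr p (fun ω => (∀ q ∈ t, M.R q.1 q.2 ω = r q) ∧ ∀ j ∈ u, X j ω = x j)
      = (∏ q ∈ t, pr p (fun ω => M.R q.1 q.2 ω = r q)) * ∏ j ∈ u, pr p (fun ω => X j ω = x j) := by
  have full : ∀ (x : ℕ → 𝒳) (r : ℕ × ℕ → M.Rv),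
      pr p (fun ω => (∀ q ∈ range k ×ˢ range n, M.R q.1 q.2 ω = r q) ∧ ∀ j ∈ range n, X j ω = x j)
      = (∏ q ∈ range k ×ˢ range n, pr p (fun ω => M.R q.1 q.2 ω = r q))
        * ∏ j ∈ range n, pr p (fun ω => X j ω = x j) := by
    intro x r
    have h := fun m => M.indep m (fun i j => r (i, j)) x
    simp only [hprod x, mul_assoc] at h
    have hR : ∀ ω, (∀ q ∈ range k ×ˢ range n, M.R q.1 q.2 ω = r q)
        ↔ ∀ i < k, ∀ j < n, M.R i j ω = r (i, j) := by
      intro ω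
      simp only [Finset.mem_product, Finset.mem_range, Prod.forall]
      exact ⟨fun h i hi j hj => h i j ⟨hi, hj⟩, fun h i j hij => h i hij.1 j hij.2⟩
    simp only [hR, Finset.mem_range, Finset.prod_product]
    rw [← sum_pr_and_eq M.init]
    simp only [h]
    rw [← Finset.sum_mul]
    have total := sum_pr_and_eq (p := p) M.init fun _ => True
    simp only [and_true, pr_true hp] at total
    rw [total, one_mul]
  have seeds := fun x => pr_forall_mem_of_subset (Y := fun q => M.R q.1 q.2) hp ht (full x)
  have stream := pr_forall_mem_of_subset (Y := X) (s := range n)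
    (E := fun ω => ∀ q ∈ t, M.R q.1 q.2 ω = r q)
    (c := ∏ q ∈ t, pr p (fun ω => M.R q.1 q.2 ω = r q)) hp hu
    (fun x => by rw [mul_comm, ← seeds x r]; simp only [and_comm]) x
  rw [mul_comm, ← stream]
  simp only [and_comm]

/-- The stream elements and seeds consumed by the first `j` steps of the passes. -/
def Alg.history (M : Alg Ω p 𝒳 n k X) (j : ℕ) (ω : Ω) : Fin n → Option (𝒳 × (Fin k → M.Rv)) :=
  fun l => if l.1 < j then some (X l ω, fun i => M.R i l ω) else none

lemma Alg.history_eq_iff (M : Alg Ω p 𝒳 n k X) {j : ℕ} (hj : j ≤ n) (ω ω' : Ω) :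
    M.history j ω = M.history j ω' ↔
      (∀ q ∈ range k ×ˢ range j, M.R q.1 q.2 ω = M.R q.1 q.2 ω') ∧
        ∀ l ∈ range j, X l ω = X l ω' := by
  simp only [Finset.mem_product, Finset.mem_range, Prod.forall]
  constructor
  · intro h
    have key : ∀ l < j, X l ω = X l ω' ∧ ∀ i < k, M.R i l ω = M.R i l ω' := by
      intro l hl
      have h1 := congrFun h ⟨l, hl.trans_le hj⟩
      simp only [Alg.history, hl, if_true, Option.some.injEq, Prod.mk.injEq] at h1
      exact ⟨h1.1, fun i hi => congrFun h1.2 ⟨i, hi⟩⟩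
    exact ⟨fun i l hil => (key l hil.2).2 i hil.1, fun l hl => (key l hl).1⟩
  · rintro ⟨hR, hX⟩
    funext l
    by_cases hl : l.1 < j
    · simp only [Alg.history, hl, if_true, Option.some.injEq, Prod.mk.injEq]
      exact ⟨hX l hl, funext fun i => hR i l ⟨i.2, hl⟩⟩
    · simp [Alg.history, hl]

/-- The history and the memory at the start of a pass determine the memory during the pass. -/
lemma Alg.st_eq_of_history_eq (M : Alg Ω p 𝒳 n k X) {i j : ℕ} (hj : j ≤ n) {ω ω' : Ω}
    (hW : M.history j ω = M.history j ω') (hN : M.passEnd i ω = M.passEnd i ω') :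
    M.st i j ω = M.st i j ω' := by
  rw [M.history_eq_iff hj] at hW
  simp only [Finset.mem_product, Finset.mem_range, Prod.forall] at hW
  obtain ⟨hR, hX⟩ := hW
  have key : ∀ l ≤ j, M.runPass i (M.passEnd i) l ω = M.runPass i (M.passEnd i) l ω' := by
    intro l
    induction l with
    | zero => exact fun _ => hN
    | succ l ih =>
      intro hl
      simp only [Alg.runPass, ih (Nat.le_of_succ_le hl)]
      split_ifs with hc
      · rw [hX l hl, hR i l ⟨hc.2, hl⟩]
      · rfl
  exact key j le_rfl

lemma Alg.H_stream_history (hp : IsPMF p) (hprod : IsProduct p n X) (M : Alg Ω p 𝒳 n k X)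
    {j : ℕ} (hj : j < n) :
    H p (fun ω => (X j ω, M.history j ω)) = H p (X j) + H p (M.history j) := by
  refine H_prod_of_indep hp fun ω => ?_
  have ht : range k ×ˢ range j ⊆ range k ×ˢ range n :=
    Finset.product_subset_product_right (Finset.range_subset_range.2 hj.le)
  have h1 := M.pr_seeds_and_stream hp hprod ht (Finset.range_subset_range.2 hj.le)
    (fun q => M.R q.1 q.2 ω) (fun l => X l ω)
  have h2 := M.pr_seeds_and_stream hp hprod ht (Finset.range_subset_range.2 hj)
    (fun q => M.R q.1 q.2 ω) (fun l => X l ω)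
  rw [Finset.prod_range_succ, ← mul_assoc, ← h1, mul_comm] at h2
  simp only [M.history_eq_iff hj.le]
  rw [← h2]
  congr 1
  ext ω'
  simp only [Finset.range_add_one, Finset.forall_mem_insert]
  tauto

lemma Alg.MI_le (hp : IsPMF p) (hprod : IsProduct p n X) (M : Alg Ω p 𝒳 n k X)
    {j : ℕ} (hj : j < n) :
    MI p (X j) (fun ω => ((fun r : Fin k => M.st r.1 j ω), (fun r : Fin k => M.passEnd r.1 ω)))
      ≤ (H p (fun ω => (M.history j ω, fun r : Fin k => M.passEnd r.1 ω)) - H p (M.history j))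
        - (H p (fun ω => (M.history (j + 1) ω, fun r : Fin k => M.passEnd r.1 ω))
          - H p (M.history (j + 1))) := by
  set N : Ω → Fin k → M.S := fun ω r => M.passEnd r.1 ω with hN
  set Q : Ω → Fin k → M.S := fun ω r => M.st r.1 j ω with hQ
  set W := M.history j with hW
  set W' := M.history (j + 1) with hW'
  have hMI := MI_eq hp (X j) fun ω => (Q ω, N ω)
  have hind : H p (fun ω => (X j ω, W ω)) = _ := M.H_stream_history hp hprod hj
  have hsub := H_submodular hp (X j) W fun ω => (Q ω, N ω)
  have hQdet : H p (fun ω => (W ω, Q ω, N ω)) ≤ H p (fun ω => (W ω, N ω)) := by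
    refine H_le_of_determines hp fun ω ω' h => ?_
    simp only [Prod.mk.injEq] at h ⊢
    exact ⟨h.1, funext fun r => M.st_eq_of_history_eq hj.le h.1 (congrFun h.2 r), h.2⟩
  have hdrop : H p (fun ω => (N ω, X j ω, W ω)) ≤ H p (fun ω => (X j ω, W ω, Q ω, N ω)) :=
    H_le_of_determines hp (by simp +contextual)
  have hsub' := H_submodular hp N W' fun ω => (X j ω, W ω)
  have hstep : H p (fun ω => (W' ω, X j ω, W ω)) ≤ H p W' := by
    refine H_le_of_determines hp fun ω ω' h => ?_
    have h' := h
    rw [hW', M.history_eq_iff hj] at h'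
    simp only [Prod.mk.injEq]
    refine ⟨h, h'.2 j (by simp), (M.history_eq_iff hj.le ω ω').2 ⟨fun q hq => h'.1 q ?_,
      fun l hl => h'.2 l ?_⟩⟩
    · simp only [Finset.mem_product, Finset.mem_range] at hq ⊢; omega
    · simp only [Finset.mem_range] at hl ⊢; omega
  have hdrop' : H p (fun ω => (W' ω, N ω)) ≤ H p (fun ω => (N ω, W' ω, X j ω, W ω)) :=
    H_le_of_determines hp (by simp +contextual)
  linarith

end Streaming

/-- final inequality chain in the proof of Claim `cl:acomb`: for a
`k`-pass streaming algorithm `M` on an input stream drawn from a product distribution,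
`Σ_{j=1}^{n} I(X_j; M_{(≤k,j-1)}, M_{<k}) ≤ H(M_{<k})`.
(0-shifted indices: the paper's `X_j` is `X (j-1)`, `M_{(r,q)}` is `M.st (r-1) q`, and
`M_r` is `M.passEnd r`.) -/
theorem sum_mi_le_entropy_passEnds
    {Ω : Type} [Fintype Ω] {p : Ω → ℝ} {𝒳 : Type} [Fintype 𝒳] {n k : ℕ}
    {X : ℕ → Ω → 𝒳}
    (hp : IsPMF p) (hprod : IsProduct p n X)
    (M : Alg Ω p 𝒳 n k X) :
    ∑ j ∈ Finset.range n,
        MI p (X j)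
          (fun ω => ((fun r : Fin k => M.st r.1 j ω),
                     (fun r : Fin k => M.passEnd r.1 ω)))
      ≤ H p (fun ω => fun r : Fin k => M.passEnd r.1 ω) := by
  refine (Finset.sum_le_sum fun j hj => M.MI_le hp hprod (Finset.mem_range.1 hj)).trans ?_
  rw [Finset.sum_range_sub' fun j =>
    H p (fun ω => (M.history j ω, fun r : Fin k => M.passEnd r.1 ω)) - H p (M.history j)]
  have hstart : H p (fun ω => (M.history 0 ω, fun r : Fin k => M.passEnd r.1 ω))
      ≤ H p (fun ω => fun r : Fin k => M.passEnd r.1 ω) := by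
    refine H_le_of_determines hp fun ω ω' h => ?_
    simp only [Prod.mk.injEq]
    exact ⟨(M.history_eq_iff (Nat.zero_le n) ω ω').2 (by simp), h⟩
  have hend : H p (M.history n)
      ≤ H p (fun ω => (M.history n ω, fun r : Fin k => M.passEnd r.1 ω)) :=
    H_le_of_determines hp (by simp +contextual)
  have := H_nonneg hp (M.history 0)
  linarith

end MultiPassIC
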